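/- There exists a constant C > 0 such that every nontrivial zero ρ of the Riemann zeta function with Im ρ ≥ 3 has order of vanishing m(ρ) ≤ C · log(Im ρ). -/

import Mathlib

open Complex Filter Topology Metric

/-- `s - 1` times the error of the trapezoidal rule for `x ↦ x ^ (-s)` on `[a, a + 1]`. -/
noncomputable def cpowTrapezoidError (a : ℝ) (s : ℂ) : ℂ :=
  (s - 1) * (((a : ℂ) ^ (-s) + ((a + 1 : ℝ) : ℂ) ^ (-s)) / 2) -
    ((a : ℂ) ^ (1 - s) - ((a + 1 : ℝ) : ℂ) ^ (1 - s))

lemma hasDerivAt_ofReal_add_cpow {a t : ℝ} (h : 0 < a + t) (w : ℂ) :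
    HasDerivAt (fun t : ℝ ↦ ((a + t : ℝ) : ℂ) ^ w) (w * ((a + t : ℝ) : ℂ) ^ (w - 1)) t := by
  have h1 : HasDerivAt (fun z : ℂ ↦ (a : ℂ) + z) 1 (t : ℂ) := (hasDerivAt_id _).const_add _
  have h2 : (a : ℂ) + t ∈ slitPlane := by
    rw [← ofReal_add]; exact ofReal_mem_slitPlane.2 h
  simpa using (h1.cpow_const (c := w) h2).comp_ofReal

lemma norm_cpowTrapezoidError_le {a : ℝ} (ha : 0 < a) {s : ℂ} (hs : -2 ≤ s.re) :
    ‖cpowTrapezoidError a s‖ ≤ ‖s - 1‖ * ‖s‖ * ‖s + 1‖ * a ^ (-s.re - 2) := by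
  set B := ‖s - 1‖ * ‖s‖ * ‖s + 1‖ * a ^ (-s.re - 2) with hB
  have hB0 : 0 ≤ B := by positivity
  let p : ℝ → ℂ → ℂ := fun t w ↦ ((a + t : ℝ) : ℂ) ^ w
  let f : ℝ → ℂ := fun t ↦ (s - 1) * (t * ((p 0 (-s) + p t (-s)) / 2)) - (p 0 (1 - s) - p t (1 - s))
  let f' : ℝ → ℂ := fun t ↦
    (s - 1) * ((p 0 (-s) - p t (-s)) / 2 - s * t * p t (-s - 1) / 2)
  let f'' : ℝ → ℂ := fun t ↦ (s - 1) * s * (s + 1) * (t / 2) * p t (-s - 2)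
  have hp (t : ℝ) (ht : 0 ≤ t) (w : ℂ) : HasDerivAt (fun t ↦ p t w) (w * p t (w - 1)) t :=
    hasDerivAt_ofReal_add_cpow (by positivity) w
  have hid (t : ℝ) : HasDerivAt (fun t : ℝ ↦ (t : ℂ)) 1 t := (hasDerivAt_id (t : ℂ)).comp_ofReal
  have hf (t : ℝ) (ht : 0 ≤ t) : HasDerivAt f (f' t) t := by
    refine ((((hid t).mul (((hp t ht (-s)).const_add (p 0 (-s))).div_const 2)).const_mul
      (s - 1)).sub ((hp t ht (1 - s)).const_sub (p 0 (1 - s)))).congr_deriv ?_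
    simp only [f']
    rw [show (1 - s - 1 : ℂ) = -s by ring]
    ring
  have hf' (t : ℝ) (ht : 0 ≤ t) : HasDerivAt f' (f'' t) t := by
    refine (((((hp t ht (-s)).const_sub (p 0 (-s))).div_const 2).sub
      ((((hid t).const_mul s).mul (hp t ht (-s - 1))).div_const 2)).const_mul (s - 1)).congr_deriv ?_
    simp only [f'']
    rw [show (-s - 1 - 1 : ℂ) = -s - 2 by ring]
    ring
  have hf''le (t : ℝ) (ht : t ∈ Set.Icc (0 : ℝ) 1) : ‖f'' t‖ ≤ B := by
    obtain ⟨h0, h1⟩ := ht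
    have hpt : ‖p t (-s - 2)‖ ≤ a ^ (-s.re - 2) := by
      simp only [p]
      rw [norm_cpow_eq_rpow_re_of_pos (by positivity)]
      simpa using Real.rpow_le_rpow_of_nonpos ha (by linarith : a ≤ a + t)
        (by linarith : -s.re - 2 ≤ 0)
    have ht2 : ‖(t / 2 : ℂ)‖ ≤ 1 := by
      rw [norm_div, norm_real, Real.norm_of_nonneg h0]; norm_num; linarith
    simp only [f'', norm_mul, hB]
    calc _ ≤ ‖s - 1‖ * ‖s‖ * ‖s + 1‖ * 1 * a ^ (-s.re - 2) := by gcongr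
      _ = _ := by ring
  have hf'le (t : ℝ) (ht : t ∈ Set.Icc (0 : ℝ) 1) : ‖f' t‖ ≤ B := by
    have h := norm_image_sub_le_of_norm_deriv_le_segment' (f := f') (f' := f'') (a := 0) (b := 1)
      (C := B) (fun x hx ↦ (hf' x hx.1).hasDerivWithinAt)
      (fun x hx ↦ hf''le x (Set.Ico_subset_Icc_self hx)) t ht
    have h0 : f' 0 = 0 := by simp [f']
    rw [h0, sub_zero] at h
    nlinarith [ht.1, ht.2]
  have h := norm_image_sub_le_of_norm_deriv_le_segment_01' (f := f) (f' := f')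
      (C := B) (fun x hx ↦ (hf x hx.1).hasDerivWithinAt)
      (fun x hx ↦ hf'le x (Set.Ico_subset_Icc_self hx))
  have h0 : f 0 = 0 := by simp [f]
  have h1 : f 1 = cpowTrapezoidError a s := by simp [f, p, cpowTrapezoidError]
  rwa [h0, h1, sub_zero] at h

lemma differentiable_cpowTrapezoidError {a : ℝ} (ha : 0 < a) :
    Differentiable ℂ (cpowTrapezoidError a) := by
  have h1 : (a : ℂ) ≠ 0 := by exact_mod_cast ha.ne'
  have h2 : ((a + 1 : ℝ) : ℂ) ≠ 0 := by exact_mod_cast (by positivity : a + 1 ≠ 0)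
  have hd (b : ℂ) (hb : b ≠ 0) (u : ℂ → ℂ) (hu : Differentiable ℂ u) :
      Differentiable ℂ fun s ↦ b ^ u s := fun s ↦ (hu s).const_cpow (.inl hb)
  unfold cpowTrapezoidError
  exact ((by fun_prop : Differentiable ℂ fun s : ℂ ↦ s - 1).mul
    (((hd _ h1 _ (by fun_prop)).add (hd _ h2 _ (by fun_prop))).div_const 2)).sub
    ((hd _ h1 _ (by fun_prop)).sub (hd _ h2 _ (by fun_prop)))

lemma summable_nat_add_one_rpow_neg_five_quarters :
    Summable fun n : ℕ ↦ (n + 1 : ℝ) ^ (-(5 / 4) : ℝ) := by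
  have := (summable_nat_add_iff 1).2
    (Real.summable_nat_rpow (p := -(5 / 4)) |>.2 (by norm_num))
  simpa using this

lemma norm_cpowTrapezoidError_nat_le (n : ℕ) {s : ℂ} (hs : -(3 / 4) ≤ s.re) :
    ‖cpowTrapezoidError (n + 1) s‖ ≤
      ‖s - 1‖ * ‖s‖ * ‖s + 1‖ * (n + 1 : ℝ) ^ (-(5 / 4) : ℝ) := by
  refine (norm_cpowTrapezoidError_le (by positivity) (by linarith)).trans ?_
  gcongr ?_ * ?_
  exact Real.rpow_le_rpow_of_exponent_le (by linarith [n.cast_nonneg (α := ℝ)]) (by linarith)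

lemma summable_cpowTrapezoidError {s : ℂ} (hs : -(3 / 4) ≤ s.re) :
    Summable fun n : ℕ ↦ cpowTrapezoidError (n + 1) s :=
  .of_norm_bounded (summable_nat_add_one_rpow_neg_five_quarters.mul_left _)
    fun n ↦ norm_cpowTrapezoidError_nat_le n hs

lemma tsum_cpowTrapezoidError_of_one_lt_re {s : ℂ} (hs : 1 < s.re) :
    ∑' n : ℕ, cpowTrapezoidError (n + 1) s = (s - 1) * riemannZeta s - (s - 1) / 2 - 1 := by
  let b : ℕ → ℂ := fun n ↦ ((n + 1 : ℝ) : ℂ) ^ (-s)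
  let c : ℕ → ℂ := fun n ↦ ((n + 1 : ℝ) : ℂ) ^ (1 - s)
  have hbs : Summable b := by
    have := (summable_nat_add_iff 1).2 (summable_one_div_nat_cpow.2 hs)
    refine this.congr fun n ↦ ?_
    simp [b, cpow_neg]
  have hb : HasSum b (riemannZeta s) := by
    convert hbs.hasSum
    rw [zeta_eq_tsum_one_div_nat_add_one_cpow hs]
    exact tsum_congr fun n ↦ by simp [b, cpow_neg]
  have hb1 : HasSum (fun n ↦ b (n + 1)) (riemannZeta s - 1) := by
    rw [hasSum_nat_add_iff' 1 |>.symm] at hb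
    simpa [b] using hb
  have hE := (summable_cpowTrapezoidError (s := s) (by linarith)).hasSum
  have hmain := (((hb.add hb1).div_const 2).mul_left (s - 1)).sub hE
  have hcT : Tendsto c atTop (𝓝 0) := by
    rw [tendsto_zero_iff_norm_tendsto_zero]
    have h := (tendsto_rpow_neg_atTop (by linarith : 0 < s.re - 1)).comp
      (tendsto_natCast_atTop_atTop.comp (tendsto_add_atTop_nat 1))
    refine h.congr fun n ↦ ?_
    simp only [c, Function.comp]
    rw [norm_cpow_eq_rpow_re_of_pos (by positivity)]
    simp
  have hct : Tendsto (fun N ↦ ∑ n ∈ Finset.range N, (c n - c (n + 1))) atTop (𝓝 (1 - 0)) := by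
    simp_rw [Finset.sum_range_sub']
    have : c 0 = 1 := by simp [c]
    rw [← this]
    exact tendsto_const_nhds.sub hcT
  have huniq := tendsto_nhds_unique hct (hmain.tendsto_sum_nat.congr fun N ↦
    Finset.sum_congr rfl fun n _ ↦ by simp [cpowTrapezoidError, b, c])
  linear_combination huniq

lemma tsum_cpowTrapezoidError {s : ℂ} (hs : -(3 / 4) < s.re) (h1 : s ≠ 1) :
    ∑' n : ℕ, cpowTrapezoidError (n + 1) s = (s - 1) * riemannZeta s - (s - 1) / 2 - 1 := by
  set K := ‖s‖ + 3 with hK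
  let U : Set ℂ := {z | -(3 / 4) < z.re} ∩ ball 0 K
  have hUo : IsOpen U := (isOpen_lt continuous_const continuous_re).inter isOpen_ball
  have hUc : Convex ℝ U := (convex_halfSpace_re_gt _).inter (convex_ball _ _)
  have hL : DifferentiableOn ℂ (fun z ↦ ∑' n : ℕ, cpowTrapezoidError (n + 1) z) U := by
    refine differentiableOn_tsum_of_summable_norm
      (summable_nat_add_one_rpow_neg_five_quarters.mul_left ((K + 1) * K * (K + 1)))
      (fun n ↦ (differentiable_cpowTrapezoidError (by positivity)).differentiableOn) hUo ?_
    intro n z hz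
    have hzK : ‖z‖ ≤ K := (mem_ball_zero_iff.1 hz.2).le
    refine (norm_cpowTrapezoidError_nat_le n hz.1.le).trans ?_
    gcongr
    · exact (norm_sub_le _ _).trans (by simpa)
    · exact (norm_add_le _ _).trans (by simpa)
  have hR : DifferentiableOn ℂ (fun z ↦ riemannZeta₁ z - (z - 1) / 2 - 1) U := by
    fun_prop
  have hζ (z : ℂ) (hz : z ≠ 1) : riemannZeta₁ z = (z - 1) * riemannZeta z := by
    rw [riemannZeta_eq_inv_sub_mul hz, mul_inv_cancel_left₀ (sub_ne_zero.2 hz)]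
  have h2 : (2 : ℂ) ∈ U := by
    refine ⟨by simp; norm_num, ?_⟩
    simp [hK]; linarith [norm_nonneg s]
  have heq := (hL.analyticOnNhd hUo).eqOn_of_preconnected_of_eventuallyEq (hR.analyticOnNhd hUo)
    hUc.isPreconnected h2 (by
      filter_upwards [(isOpen_lt continuous_const continuous_re).mem_nhds
        (show (1 : ℝ) < (2 : ℂ).re by simp)] with z hz
      rw [tsum_cpowTrapezoidError_of_one_lt_re hz, hζ z]
      rintro rfl
      simp at hz)
  rw [← hζ s h1]
  exact heq ⟨hs, by simp [hK]⟩

/-- Polynomial growth of `ζ` in the half plane `-3/4 < Re s`. -/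
lemma exists_norm_riemannZeta_le : ∃ A : ℝ, 0 < A ∧ ∀ s : ℂ, -(3 / 4) < s.re → s ≠ 1 →
    ‖riemannZeta s‖ ≤ 1 / 2 + ‖s - 1‖⁻¹ + A * (‖s‖ * ‖s + 1‖) := by
  refine ⟨∑' n : ℕ, (n + 1 : ℝ) ^ (-(5 / 4) : ℝ),
    summable_nat_add_one_rpow_neg_five_quarters.tsum_pos (fun n ↦ by positivity) 0 (by simp), ?_⟩
  intro s hs h1
  have h := tsum_of_norm_bounded (summable_nat_add_one_rpow_neg_five_quarters.hasSum.mul_left _)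
    fun n ↦ norm_cpowTrapezoidError_nat_le n hs.le
  set A := ∑' n : ℕ, (n + 1 : ℝ) ^ (-(5 / 4) : ℝ)
  have hs1 : s - 1 ≠ 0 := sub_ne_zero.2 h1
  have hz : riemannZeta s = 1 / 2 + (s - 1)⁻¹ +
      (s - 1)⁻¹ * ∑' n : ℕ, cpowTrapezoidError (n + 1) s := by
    rw [tsum_cpowTrapezoidError hs h1]
    field_simp
    ring
  rw [hz]
  refine (norm_add_le _ _).trans (add_le_add ((norm_add_le _ _).trans (by simp)) ?_)
  rw [norm_mul, norm_inv, inv_mul_le_iff₀ (by positivity)]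
  linarith

lemma two_sub_pi_sq_div_six_le_norm_riemannZeta {s : ℂ} (hs : s.re = 2) :
    2 - Real.pi ^ 2 / 6 ≤ ‖riemannZeta s‖ := by
  have h1 : 1 < s.re := by rw [hs]; norm_num
  have hsum := (summable_nat_add_iff 2).2 (summable_one_div_nat_cpow.2 h1)
  have hz : riemannZeta s = 1 + ∑' n : ℕ, 1 / ((n + 2 : ℕ) : ℂ) ^ s := by
    rw [zeta_eq_tsum_one_div_nat_cpow h1,
      ← (summable_one_div_nat_cpow.2 h1).sum_add_tsum_nat_add 2]
    have : s ≠ 0 := by rintro rfl; simp at hs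
    simp [Finset.sum_range_succ, zero_cpow this]
  have hR := (hasSum_nat_add_iff' 2).2 hasSum_zeta_two
  have hb := tsum_of_norm_bounded hR (f := fun n : ℕ ↦ 1 / ((n + 2 : ℕ) : ℂ) ^ s) fun n ↦ by
    rw [norm_div, norm_one, norm_natCast_cpow_of_pos (by positivity), hs]
    simp
  have := norm_sub_le_norm_add (1 : ℂ) (∑' n : ℕ, 1 / ((n + 2 : ℕ) : ℂ) ^ s)
  rw [hz]
  simp [Finset.sum_range_succ] at hb this ⊢
  linarith

/-- Schwarz-type estimate at the centre of a disc for a function vanishing to order `m` at `ρ`. -/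
lemma norm_center_le_of_iteratedDeriv_eq_zero {f : ℂ → ℂ} {c ρ : ℂ} {R M : ℝ} (hR : 0 < R)
    (hf : ∀ z ∈ closedBall c R, AnalyticAt ℂ f z) (hM : ∀ z ∈ sphere c R, ‖f z‖ ≤ M)
    (hρ : ρ ∈ ball c R) {m : ℕ} (hm : ∀ k < m, iteratedDeriv k f ρ = 0) :
    ‖f c‖ * R ^ m ≤ M * ‖ρ - c‖ ^ m := by
  have hfρ := hf ρ (ball_subset_closedBall hρ)
  obtain ⟨g, hg, hfg⟩ := (natCast_le_analyticOrderAt hfρ).1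
    ((natCast_le_analyticOrderAt_iff_iteratedDeriv_eq_zero hfρ).2 hm)
  classical
  let q : ℂ → ℂ := Function.update (fun z ↦ f z / (z - ρ) ^ m) ρ (g ρ)
  have hqf : ∀ z ∈ closedBall c R, f z = (z - ρ) ^ m * q z := by
    intro z _
    rcases eq_or_ne z ρ with rfl | hz
    · simpa [q] using hfg.self_of_nhds
    · have : (z - ρ) ^ m ≠ 0 := pow_ne_zero _ (sub_ne_zero.2 hz)
      simp only [q, Function.update_of_ne hz]
      field_simp
  have hq : ∀ z ∈ closedBall c R, DifferentiableAt ℂ q z := by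
    intro z hzR
    rcases eq_or_ne z ρ with rfl | hz
    · refine hg.differentiableAt.congr_of_eventuallyEq ?_
      filter_upwards [hfg] with w hw
      rcases eq_or_ne w z with rfl | hwz
      · simp [q]
      · have : (w - z) ^ m ≠ 0 := pow_ne_zero _ (sub_ne_zero.2 hwz)
        simp only [q, Function.update_of_ne hwz, hw, smul_eq_mul]
        field_simp
    · have h : DifferentiableAt ℂ (fun z ↦ f z / (z - ρ) ^ m) z :=
        (hf z hzR).differentiableAt.div (by fun_prop) (pow_ne_zero _ (sub_ne_zero.2 hz))
      refine h.congr_of_eventuallyEq ?_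
      filter_upwards [isOpen_ne.mem_nhds hz] with w hw
      simp [q, Function.update_of_ne hw]
  let h : ℂ → ℂ := fun z ↦ q z * (R ^ 2 - starRingEnd ℂ (ρ - c) * (z - c)) ^ m
  have hh : DiffContOnCl ℂ h (ball c R) := by
    refine DifferentiableOn.diffContOnCl fun z hz ↦ ?_
    rw [closure_ball c hR.ne'] at hz
    exact ((hq z hz).mul (by fun_prop)).differentiableWithinAt
  have hbd : ∀ z ∈ frontier (ball c R), ‖h z‖ ≤ M * R ^ m := by
    intro z hz
    rw [frontier_ball c hR.ne'] at hz
    have hzR : ‖z - c‖ = R := mem_sphere_iff_norm.1 hz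
    have hfac : (R ^ 2 - starRingEnd ℂ (ρ - c) * (z - c) : ℂ) =
        starRingEnd ℂ (z - ρ) * (z - c) := by
      have : (R ^ 2 : ℂ) = starRingEnd ℂ (z - c) * (z - c) := by
        rw [← hzR, conj_mul']
      rw [this]
      simp only [map_sub]
      ring
    have hn : ‖(R ^ 2 - starRingEnd ℂ (ρ - c) * (z - c) : ℂ)‖ = ‖z - ρ‖ * R := by
      rw [hfac, norm_mul, norm_conj, hzR]
    calc ‖h z‖ = ‖f z‖ * R ^ m := by
          rw [hqf z (sphere_subset_closedBall hz)]
          simp only [h, norm_mul, norm_pow, hn]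
          ring
      _ ≤ _ := by gcongr; exact hM z hz
  have hc := Complex.norm_le_of_forall_mem_frontier_norm_le isBounded_ball hh hbd
    (subset_closure (mem_ball_self hR))
  have hhc : ‖h c‖ = ‖q c‖ * R ^ m * R ^ m := by
    simp [h, abs_of_pos hR]
    ring
  have hqc : ‖q c‖ * R ^ m ≤ M := by
    rw [hhc] at hc
    exact le_of_mul_le_mul_right hc (by positivity)
  rw [hqf c (mem_closedBall_self hR.le), norm_mul, norm_pow, norm_sub_rev c ρ]
  calc _ = (‖q c‖ * R ^ m) * ‖ρ - c‖ ^ m := by ring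
    _ ≤ _ := by gcongr

/-- There is a constant `C > 0` such that every nontrivial zero `ρ` of the Riemann zeta
function with `Im ρ ≥ 3` has order of vanishing `m(ρ) ≤ C · log (Im ρ)`.  The order of
vanishing being at most `B` is expressed by: whenever all iterated derivatives of `ζ` at `ρ`
of order `< m` vanish (i.e. `ζ` vanishes to order at least `m` at `ρ`), then `m ≤ B`. -/
theorem zeta_zero_multiplicity_le_log :
    ∃ C : ℝ, 0 < C ∧ ∀ ρ : ℂ, riemannZeta ρ = 0 → 0 < ρ.re → ρ.re < 1 → 3 ≤ ρ.im →
      ∀ m : ℕ, (∀ k < m, iteratedDeriv k riemannZeta ρ = 0) →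
        (m : ℝ) ≤ C * Real.log ρ.im := by
  obtain ⟨A, hA, hζ⟩ := exists_norm_riemannZeta_le
  set δ : ℝ := 2 - Real.pi ^ 2 / 6 with hδ
  have hδ0 : 0 < δ := by nlinarith [Real.pi_lt_d2, Real.pi_pos]
  set K : ℝ := (3 + 9 * A) / δ + 1 with hK
  have hK1 : 1 < K := by rw [hK]; linarith [show 0 < (3 + 9 * A) / δ by positivity]
  have hlogK : 0 < Real.log K := Real.log_pos hK1
  have hl54 : 0 < Real.log (5 / 4) := Real.log_pos (by norm_num)
  refine ⟨(Real.log K + 2) / Real.log (5 / 4), by positivity, ?_⟩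
  intro ρ _ h0 h1 h3 m hm
  set γ := ρ.im with hγ
  let c : ℂ := ⟨2, γ⟩
  have hre (z : ℂ) (hz : z ∈ closedBall c (5 / 2)) : -(1 / 2) ≤ z.re ∧ 1 / 2 ≤ z.im := by
    have hz' : ‖z - c‖ ≤ 5 / 2 := mem_closedBall_iff_norm.1 hz
    have hr := (abs_le.1 ((abs_re_le_norm _).trans hz')).1
    have hi := (abs_le.1 ((abs_im_le_norm _).trans hz')).1
    simp [c] at hr hi
    constructor <;> linarith
  have hne (z : ℂ) (hz : z ∈ closedBall c (5 / 2)) : z ≠ 1 := by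
    rintro rfl
    have := (hre 1 hz).2
    norm_num at this
  have hcn : ‖c‖ ≤ 2 + γ := by
    refine (norm_le_abs_re_add_abs_im c).trans ?_
    simp [c, abs_of_nonneg (by linarith : 0 ≤ γ)]
  have hbd : ∀ z ∈ sphere c (5 / 2), ‖riemannZeta z‖ ≤ (3 + 9 * A) * γ ^ 2 := by
    intro z hz
    have hz' := sphere_subset_closedBall hz
    obtain ⟨hzr, hzi⟩ := hre z hz'
    have hzn : ‖z‖ ≤ γ + 9 / 2 := by
      have := norm_add_le (z - c) c
      rw [sub_add_cancel, mem_sphere_iff_norm.1 hz] at this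
      linarith
    have hz1 : ‖z + 1‖ ≤ γ + 11 / 2 := by
      have := norm_add_le z 1
      rw [norm_one] at this
      linarith
    have hinv : ‖z - 1‖⁻¹ ≤ 2 := by
      have hi := (le_abs_self _).trans (abs_im_le_norm (z - 1))
      simp at hi
      rw [inv_le_comm₀ (by linarith) (by norm_num)]
      linarith
    have hprod : ‖z‖ * ‖z + 1‖ ≤ 9 * γ ^ 2 := by
      calc _ ≤ (γ + 9 / 2) * (γ + 11 / 2) := by gcongr
        _ ≤ 9 * γ ^ 2 := by nlinarith
    have := hζ z (by linarith) (hne z hz')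
    nlinarith [mul_le_mul_of_nonneg_left hprod hA.le]
  have hρc : ‖ρ - c‖ ≤ 2 := by
    refine (norm_le_abs_re_add_abs_im _).trans ?_
    simp [c, ← hγ]
    rw [abs_le]
    constructor <;> linarith
  have key := norm_center_le_of_iteratedDeriv_eq_zero (by norm_num : (0 : ℝ) < 5 / 2)
    (fun z hz ↦ analyticOn_riemannZeta z (hne z hz)) hbd
    (mem_ball_iff_norm.2 (hρc.trans_lt (by norm_num))) hm
  have hlow : δ ≤ ‖riemannZeta c‖ := two_sub_pi_sq_div_six_le_norm_riemannZeta rfl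
  have hpow : (5 / 4 : ℝ) ^ m ≤ K * γ ^ 2 := by
    have h : δ * (5 / 2) ^ m ≤ (3 + 9 * A) * γ ^ 2 * 2 ^ m :=
      calc _ ≤ ‖riemannZeta c‖ * (5 / 2) ^ m := by gcongr
        _ ≤ _ := key
        _ ≤ _ := by gcongr
    have h54 : (5 / 2 : ℝ) ^ m = (5 / 4) ^ m * 2 ^ m := by rw [← mul_pow]; norm_num
    rw [h54, ← mul_assoc] at h
    have h' := le_of_mul_le_mul_right h (by positivity)
    calc (5 / 4 : ℝ) ^ m ≤ (3 + 9 * A) * γ ^ 2 / δ := by rw [le_div_iff₀ hδ0]; linarith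
      _ = (3 + 9 * A) / δ * γ ^ 2 := by ring
      _ ≤ K * γ ^ 2 := by gcongr; linarith
  have hlog := Real.log_le_log (by positivity) hpow
  rw [Real.log_pow, Real.log_mul (by positivity) (by positivity), Real.log_pow] at hlog
  have hlγ : 1 ≤ Real.log γ := by
    rw [Real.le_log_iff_exp_le (by linarith)]
    linarith [Real.exp_one_lt_d9]
  rw [div_mul_eq_mul_div, le_div_iff₀ hl54]
  push_cast at hlog
  nlinarith
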